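/- arXiv:2401.08828 — 2 statements merged into one kernel-verified Lean document; each statement's English description precedes it below -/
import Mathlib

section
/- Let p be a prime and \phi : \mathbb{Z}_p^n \to \mathbb{R} a bounded function which is locally constant outside of some closed set of measure zero. Let (\mathcal{U},\mathbf{k},\mathbf{c}) be an Ekedahl-admissible triple with \prod_{q prime}(1-\mu_q(\mathcal{U}_q)) > 0. Then lim_{X\to\infty} (\sum_{x \in V^{\mathcal{U}}_{\mathbf{k},\mathbf{c}}(X)} \phi(x)) / #V^{\mathcal{U}}_{\mathbf{k},\mathbf{c}}(X) = (\int_{\mathbb{Z}_p^n \setminus \mathcal{U}_p} \phi \, d\mu_p) / (1 - \mu_p(\mathcal{U}_p)). -/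
open MeasureTheory Filter Topology

noncomputable section

instance (p : Nat.Primes) : Fact (p : ℕ).Prime := ⟨p.2⟩
instance (p : ℕ) [Fact p.Prime] : MeasurableSpace ℤ_[p] := borel _
instance (p : ℕ) [Fact p.Prime] : BorelSpace ℤ_[p] := ⟨rfl⟩

/-- The set of lattice points of the box `V_{k,c}(X) = ∏ᵢ [-(cᵢX)^{1/kᵢ}, (cᵢX)^{1/kᵢ}]`. -/
def latticeBox (n : ℕ) (k : Fin n → ℕ) (c : Fin n → ℝ) (X : ℝ) : Set (Fin n → ℤ) :=
  {x | ∀ i, |(x i : ℝ)| ≤ (c i * X) ^ ((k i : ℝ)⁻¹)}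

/-- The volume of the box `V_{k,c}(X)`. -/
def boxVol (n : ℕ) (k : Fin n → ℕ) (c : Fin n → ℝ) (X : ℝ) : ℝ :=
  ∏ i : Fin n, (2 * (c i * X) ^ ((k i : ℝ)⁻¹))

/-- The diagonal embedding `ℤ^n → ℤ_p^n`. -/
def padicEmbed (n : ℕ) (p : Nat.Primes) (x : Fin n → ℤ) : Fin n → ℤ_[p] :=
  fun i => ((x i : ℤ) : ℤ_[p])

/-- The sieved set `V^𝒰_{k,c}(X)` of lattice points in the box avoiding every `𝒰_p`. -/
def sievedBox (n : ℕ) (k : Fin n → ℕ) (c : Fin n → ℝ)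
    (U : (p : Nat.Primes) → Set (Fin n → ℤ_[p])) (X : ℝ) : Set (Fin n → ℤ) :=
  {x | x ∈ latticeBox n k c X ∧ ∀ p : Nat.Primes, padicEmbed n p x ∉ U p}

/-- Ekedahl admissibility of the triple `(𝒰, k, c)`. -/
def EkedahlAdmissible (n : ℕ) (k : Fin n → ℕ) (c : Fin n → ℝ)
    (U : (p : Nat.Primes) → Set (Fin n → ℤ_[p])) : Prop :=
  Tendsto (fun Y : ℝ =>
      limsup (fun X : ℝ =>
        (({x ∈ latticeBox n k c X |
            ∃ p : Nat.Primes, Y < (p : ℕ) ∧ padicEmbed n p x ∈ U p}).ncard : ℝ)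
          / boxVol n k c X) atTop)
    atTop (𝓝 0)


lemma count1 (a M : ℤ) (hM : 0 < M) :
    Tendsto (fun B : ℝ => ((Finset.filter (fun x : ℤ => x ≡ a [ZMOD M])
      (Finset.Icc (-⌊B⌋) ⌊B⌋)).card : ℝ) / (2 * B)) atTop (𝓝 (1 / (M : ℝ))) := by
  have hMr : (1 : ℝ) ≤ M := by exact_mod_cast hM
  have key : ∀ B : ℝ, 0 ≤ B → |((Finset.filter (fun x : ℤ => x ≡ a [ZMOD M])
      (Finset.Icc (-⌊B⌋) ⌊B⌋)).card : ℝ) - 2 * B / M| ≤ 4 := by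
    intro B hB
    have h1 : Finset.Icc (-⌊B⌋) ⌊B⌋ = Finset.Ico (-⌊B⌋) (⌊B⌋ + 1) := by
      ext x; simp only [Finset.mem_Icc, Finset.mem_Ico]; omega
    have h2 := Int.Ico_filter_modEq_card (-⌊B⌋) (⌊B⌋ + 1) hM a
    rw [h1]
    have hf : 0 ≤ ⌊B⌋ := Int.floor_nonneg.2 hB
    set u : ℤ := ⌈(((⌊B⌋ + 1 : ℤ) : ℚ) - a) / (M : ℚ)⌉ with hu
    set v : ℤ := ⌈(((-⌊B⌋ : ℤ) : ℚ) - a) / (M : ℚ)⌉ with hv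
    have hMq : (0 : ℚ) < M := by exact_mod_cast hM
    have huv : v ≤ u := by
      apply Int.ceil_le_ceil
      apply div_le_div_of_nonneg_right _ hMq.le
      have : ((-⌊B⌋ : ℤ) : ℚ) ≤ ((⌊B⌋ + 1 : ℤ) : ℚ) := by
        exact_mod_cast (by omega : -⌊B⌋ ≤ ⌊B⌋ + 1)
      linarith
    rw [max_eq_left (by omega)] at h2
    have h3 : ((Finset.filter (fun x : ℤ => x ≡ a [ZMOD M])
      (Finset.Ico (-⌊B⌋) (⌊B⌋ + 1))).card : ℝ) = (u : ℝ) - v := by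
      exact_mod_cast h2
    rw [h3]
    have e1 : (((⌊B⌋ + 1 : ℤ) : ℝ) - a) / M ≤ u := by
      have h : (((⌊B⌋ + 1 : ℤ) : ℚ) - a) / (M : ℚ) ≤ (u : ℚ) := Int.le_ceil _
      exact_mod_cast h
    have e2 : (u : ℝ) < (((⌊B⌋ + 1 : ℤ) : ℝ) - a) / M + 1 := by
      have h : (u : ℚ) < (((⌊B⌋ + 1 : ℤ) : ℚ) - a) / (M : ℚ) + 1 := Int.ceil_lt_add_one _
      exact_mod_cast h
    have e3 : (((-⌊B⌋ : ℤ) : ℝ) - a) / M ≤ v := by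
      have h : (((-⌊B⌋ : ℤ) : ℚ) - a) / (M : ℚ) ≤ (v : ℚ) := Int.le_ceil _
      exact_mod_cast h
    have e4 : (v : ℝ) < (((-⌊B⌋ : ℤ) : ℝ) - a) / M + 1 := by
      have h : (v : ℚ) < (((-⌊B⌋ : ℤ) : ℚ) - a) / (M : ℚ) + 1 := Int.ceil_lt_add_one _
      exact_mod_cast h
    have f1 := Int.floor_le B
    have f2 := Int.lt_floor_add_one B
    have e5 : (((⌊B⌋ + 1 : ℤ) : ℝ) - a) / M - (((-⌊B⌋ : ℤ) : ℝ) - a) / M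
        = 2 * B / M + (2 * ⌊B⌋ + 1 - 2 * B) / M := by
      push_cast; ring
    have e6 : |(2 * (⌊B⌋ : ℝ) + 1 - 2 * B) / M| ≤ 1 := by
      rw [abs_div, abs_of_pos (by linarith : (0:ℝ) < M), div_le_one (by linarith)]
      rw [abs_le]; constructor <;> linarith
    rw [abs_le] at e6 ⊢
    constructor <;> linarith [e6.1, e6.2]
  have h0 : Tendsto (fun B : ℝ => (((Finset.filter (fun x : ℤ => x ≡ a [ZMOD M])
      (Finset.Icc (-⌊B⌋) ⌊B⌋)).card : ℝ) - 2 * B / M) / (2 * B)) atTop (𝓝 0) := by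
    have hl : Tendsto (fun B : ℝ => 4 / (2 * B)) atTop (𝓝 0) :=
      Tendsto.const_div_atTop (tendsto_id.const_mul_atTop (by norm_num)) 4
    refine squeeze_zero_norm' ?_ hl
    filter_upwards [eventually_gt_atTop 0] with B hB
    rw [norm_div, Real.norm_eq_abs, Real.norm_eq_abs, abs_of_pos (by linarith : 0 < 2 * B)]
    exact div_le_div_of_nonneg_right (key B hB.le) (by linarith)
  have h5 := h0.add_const (1 / (M : ℝ))
  rw [zero_add] at h5
  refine h5.congr' ?_
  filter_upwards [eventually_gt_atTop 0] with B hB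
  field_simp
  ring

def boxFin (n : ℕ) (k : Fin n → ℕ) (c : Fin n → ℝ) (X : ℝ) : Finset (Fin n → ℤ) :=
  Fintype.piFinset (fun i => Finset.Icc (-⌊(c i * X) ^ ((k i : ℝ)⁻¹)⌋) ⌊(c i * X) ^ ((k i : ℝ)⁻¹)⌋)

lemma coe_boxFin (n : ℕ) (k : Fin n → ℕ) (c : Fin n → ℝ) (X : ℝ) :
    (boxFin n k c X : Set (Fin n → ℤ)) = latticeBox n k c X := by
  ext x
  simp only [boxFin, Finset.mem_coe, Fintype.mem_piFinset, Finset.mem_Icc, latticeBox,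
    Set.mem_ofPred_eq]
  refine forall_congr' fun i => ?_
  rw [abs_le, Int.le_floor, neg_le, Int.le_floor]
  push_cast
  constructor <;> rintro ⟨h1, h2⟩ <;> constructor <;> linarith

lemma side_tendsto (k : ℕ) (hk : 1 ≤ k) (c : ℝ) (hc : 0 < c) :
    Tendsto (fun X : ℝ => (c * X) ^ ((k : ℝ)⁻¹)) atTop atTop := by
  have : (0 : ℝ) < (k : ℝ)⁻¹ := by
    have : (0 : ℝ) < k := by exact_mod_cast hk
    positivity
  exact (tendsto_rpow_atTop this).comp (tendsto_id.const_mul_atTop hc)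

lemma boxVol_pos (n : ℕ) (k : Fin n → ℕ) (c : Fin n → ℝ) (hc : ∀ i, 0 < c i) (X : ℝ)
    (hX : 0 < X) : 0 < boxVol n k c X := by
  refine Finset.prod_pos fun i _ => ?_
  have := Real.rpow_pos_of_pos (mul_pos (hc i) hX) ((k i : ℝ)⁻¹)
  linarith

lemma countbox (n : ℕ) (k : Fin n → ℕ) (hk : ∀ i, 1 ≤ k i) (c : Fin n → ℝ) (hc : ∀ i, 0 < c i)
    (a : Fin n → ℤ) (M : ℤ) (hM : 0 < M) :
    Tendsto (fun X : ℝ => ((Finset.filter (fun x : Fin n → ℤ => ∀ i, x i ≡ a i [ZMOD M])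
      (boxFin n k c X)).card : ℝ) / boxVol n k c X) atTop (𝓝 ((1 / (M : ℝ)) ^ n)) := by
  have h : ∀ X, ((Finset.filter (fun x : Fin n → ℤ => ∀ i, x i ≡ a i [ZMOD M])
      (boxFin n k c X)).card : ℝ) / boxVol n k c X = ∏ i : Fin n,
      (((Finset.filter (fun x : ℤ => x ≡ a i [ZMOD M])
      (Finset.Icc (-⌊(c i * X) ^ ((k i : ℝ)⁻¹)⌋) ⌊(c i * X) ^ ((k i : ℝ)⁻¹)⌋)).card : ℝ)
        / (2 * (c i * X) ^ ((k i : ℝ)⁻¹))) := by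
    intro X
    rw [Finset.prod_div_distrib, boxVol, ← Nat.cast_prod, ← Fintype.card_piFinset]
    congr 3
    ext x
    simp only [boxFin, Finset.mem_filter, Fintype.mem_piFinset]
    exact forall_and.symm
  simp_rw [h]
  have h2 : (1 / (M : ℝ)) ^ n = ∏ i : Fin n, (1 / (M : ℝ)) := by simp
  rw [h2]
  exact tendsto_finsetProd _ fun i _ => (count1 (a i) M hM).comp (side_tendsto (k i) (hk i) (c i) (hc i))

abbrev GS (n : ℕ) (S : Finset Nat.Primes) := (q : S) → Fin n → ℤ_[(q.1 : ℕ)]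

def iotaS (n : ℕ) (S : Finset Nat.Primes) (x : Fin n → ℤ) : GS n S := fun q => padicEmbed n q.1 x

def ballS (n : ℕ) (S : Finset Nat.Primes) (a : Fin n → ℤ) (m : ℕ) : Set (GS n S) :=
  {g | ∀ (q : S) (i : Fin n), (((q.1 : ℕ) : ℤ_[(q.1 : ℕ)])) ^ m ∣ g q i - ((a i : ℤ) : ℤ_[(q.1 : ℕ)])}

def modS (S : Finset Nat.Primes) (m : ℕ) : ℕ := ∏ q ∈ S, (q : ℕ) ^ m

lemma modS_pos (S : Finset Nat.Primes) (m : ℕ) : 0 < modS S m :=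
  Finset.prod_pos fun q _ => pow_pos q.2.pos m

lemma coprimeS (S : Finset Nat.Primes) (m : ℕ) :
    Set.Pairwise (S : Set Nat.Primes) (Function.onFun Nat.Coprime (fun q : Nat.Primes => (q : ℕ) ^ m)) := by
  intro a _ b _ hab
  exact Nat.Coprime.pow m m ((Nat.coprime_primes a.2 b.2).2 fun h => hab (Subtype.ext h))

lemma modS_dvd (S : Finset Nat.Primes) (m : ℕ) (z : ℤ) :
    (∀ q : S, (((q.1 : ℕ) : ℤ_[(q.1 : ℕ)])) ^ m ∣ ((z : ℤ) : ℤ_[(q.1 : ℕ)])) ↔ (modS S m : ℤ) ∣ z := by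
  simp only [PadicInt.pow_p_dvd_int_iff]
  constructor
  · intro h
    rw [modS]
    push_cast
    apply Finset.prod_dvd_of_coprime
    · intro a ha b hb hab
      have := coprimeS S m ha hb hab
      simp only [Function.onFun] at this ⊢
      exact_mod_cast Nat.isCoprime_iff_coprime.2 this
    · intro q hq
      exact h ⟨q, hq⟩
  · intro h q
    refine dvd_trans ?_ h
    rw [modS]
    push_cast
    exact Finset.dvd_prod_of_mem (fun q : Nat.Primes => ((q : ℕ) : ℤ) ^ m) q.2

lemma iota_mem_ball (n : ℕ) (S : Finset Nat.Primes) (a x : Fin n → ℤ) (m : ℕ) :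
    iotaS n S x ∈ ballS n S a m ↔ ∀ i, x i ≡ a i [ZMOD (modS S m : ℤ)] := by
  simp only [ballS, iotaS, padicEmbed, Set.mem_ofPred_eq]
  rw [forall_comm]
  refine forall_congr' fun i => ?_
  rw [Int.modEq_comm, Int.modEq_iff_dvd, ← modS_dvd]
  push_cast
  rfl

lemma crtS (n : ℕ) (S : Finset Nat.Primes) (g : GS n S) (m : ℕ) :
    ∃ a : Fin n → ℕ, (∀ i, a i < modS S m) ∧ g ∈ ballS n S (fun i => (a i : ℤ)) m := by
  classical
  have hs : ∀ q ∈ S, ((q : ℕ) ^ m) ≠ 0 := fun q _ => (pow_pos q.2.pos m).ne'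
  let r : Fin n → Nat.Primes → ℕ := fun i q => if h : q ∈ S then (g ⟨q, h⟩ i).appr m else 0
  refine ⟨fun i => Nat.chineseRemainderOfFinset (r i) (fun q : Nat.Primes => (q : ℕ) ^ m) S hs
    (coprimeS S m), fun i => Nat.chineseRemainderOfFinset_lt_prod (r i) _ hs (coprimeS S m), ?_⟩
  intro q i
  have h1 := (Nat.chineseRemainderOfFinset (r i) (fun q : Nat.Primes => (q : ℕ) ^ m) S hs
    (coprimeS S m)).2 q.1 q.2
  set b : ℕ := (Nat.chineseRemainderOfFinset (r i) (fun q : Nat.Primes => (q : ℕ) ^ m) S hs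
    (coprimeS S m)).1 with hb
  have h2 : r i q.1 = (g q i).appr m := by simp [r]
  rw [h2, Nat.modEq_iff_dvd] at h1
  have h3 := PadicInt.appr_spec m (g q i)
  rw [Ideal.mem_span_singleton] at h3
  have h4 : (((q.1 : ℕ) : ℤ_[(q.1 : ℕ)])) ^ m ∣ ((((g q i).appr m : ℤ) - (b : ℤ) : ℤ) : ℤ_[(q.1 : ℕ)]) := by
    rw [PadicInt.pow_p_dvd_int_iff]
    exact_mod_cast h1
  have h5 := dvd_add h3 h4
  push_cast at h5 ⊢
  rwa [sub_add_sub_cancel] at h5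

lemma isOpen_ballS (n : ℕ) (S : Finset Nat.Primes) (a : Fin n → ℤ) (m : ℕ) :
    IsOpen (ballS n S a m) := by
  have : ballS n S a m = ⋂ (q : S), ⋂ (i : Fin n),
      {g : GS n S | ‖g q i - ((a i : ℤ) : ℤ_[(q.1 : ℕ)])‖ < ((q.1 : ℕ) : ℝ) ^ (-(m : ℤ) + 1)} := by
    ext g
    simp only [ballS, Set.mem_ofPred_eq, Set.mem_iInter]
    refine forall_congr' fun q => forall_congr' fun i => ?_
    rw [← PadicInt.norm_le_pow_iff_norm_lt_pow_add_one, PadicInt.norm_le_pow_iff_mem_span_pow,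
      Ideal.mem_span_singleton]
  rw [this]
  refine isOpen_iInter_of_finite fun q => isOpen_iInter_of_finite fun i => ?_
  exact isOpen_lt (by fun_prop) continuous_const

lemma ballS_congr {n : ℕ} {S : Finset Nat.Primes} {a b : Fin n → ℤ} {m m' : ℕ} (h : m ≤ m')
    (hne : (ballS n S a m ∩ ballS n S b m').Nonempty) : ballS n S b m' ⊆ ballS n S a m := by
  obtain ⟨g, h1, h2⟩ := hne
  intro f hf q i
  have e1 := h1 q i
  have e2 := (pow_dvd_pow _ h).trans (h2 q i)
  have e3 := (pow_dvd_pow _ h).trans (hf q i)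
  have := dvd_add (dvd_sub e3 e2) e1
  convert this using 1
  ring

lemma piSystemS (n : ℕ) (S : Finset Nat.Primes) :
    IsPiSystem {s | ∃ a m, s = ballS n S a m} := by
  rintro _ ⟨a, m, rfl⟩ _ ⟨b, m', rfl⟩ hne
  rcases le_total m m' with h | h
  · exact ⟨b, m', Set.inter_eq_right.2 (ballS_congr h hne)⟩
  · rw [Set.inter_comm] at hne
    exact ⟨a, m, Set.inter_eq_left.2 (ballS_congr h hne)⟩

lemma smallS (n : ℕ) (S : Finset Nat.Primes) (u : Set (GS n S)) (hu : IsOpen u) (g : GS n S)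
    (hg : g ∈ u) : ∃ s ∈ {s | ∃ a m, s = ballS n S a m}, s ∈ 𝓝 g ∧ s ⊆ u := by
  obtain ⟨ε, hε, hb⟩ := Metric.isOpen_iff.1 hu g hg
  obtain ⟨m, hm⟩ := exists_pow_lt_of_lt_one hε (by norm_num : (2 : ℝ)⁻¹ < 1)
  obtain ⟨a, -, ha⟩ := crtS n S g m
  refine ⟨_, ⟨_, m, rfl⟩, (isOpen_ballS n S _ m).mem_nhds ha, ?_⟩
  intro f hf
  apply hb
  rw [Metric.mem_ball, dist_pi_lt_iff hε]
  intro q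
  rw [dist_pi_lt_iff hε]
  intro i
  have h1 := dvd_sub (hf q i) (ha q i)
  rw [sub_sub_sub_cancel_right, ← Ideal.mem_span_singleton,
    ← PadicInt.norm_le_pow_iff_mem_span_pow] at h1
  rw [dist_eq_norm]
  refine (h1.trans ?_).trans_lt hm
  rw [zpow_neg, zpow_natCast, ← inv_pow]
  have h2 : (2 : ℝ) ≤ ((q.1 : ℕ) : ℝ) := by exact_mod_cast q.1.2.two_le
  gcongr

lemma measure_ballS (n : ℕ) (S : Finset Nat.Primes) (μ : (p : Nat.Primes) → Measure (Fin n → ℤ_[p]))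
    (hμ : ∀ p, (μ p).IsAddHaarMeasure) (hμprob : ∀ p, IsProbabilityMeasure (μ p))
    (a : Fin n → ℤ) (m : ℕ) :
    (Measure.pi (fun q : S => μ q.1)).real (ballS n S a m) = (1 / ((modS S m : ℤ) : ℝ)) ^ n := by
  classical
  set ν := Measure.pi (fun q : S => μ q.1) with hν
  have htr : ∀ b : Fin n → ℤ, ν.real (ballS n S b m) = ν.real (ballS n S 0 m) := by
    intro b
    have : ballS n S b m = (fun g => -iotaS n S b + g) ⁻¹' ballS n S 0 m := by
      ext g
      simp only [ballS, Set.mem_ofPred_eq, Set.mem_preimage, Pi.add_apply, Pi.neg_apply, iotaS,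
        padicEmbed, Pi.zero_apply, Int.cast_zero, sub_zero]
      refine forall_congr' fun q => forall_congr' fun i => ?_
      rw [neg_add_eq_sub]
    rw [this, measureReal_def, measureReal_def, measure_preimage_add]
  have hcov : (⋃ b ∈ Fintype.piFinset (fun _ : Fin n => Finset.range (modS S m)),
      ballS n S (fun i => (b i : ℤ)) m) = Set.univ := by
    rw [Set.eq_univ_iff_forall]
    intro g
    obtain ⟨b, hb, hg⟩ := crtS n S g m
    simp only [Set.mem_iUnion]
    exact ⟨b, by simpa using hb, hg⟩
  have hdis : Set.PairwiseDisjoint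
      (Fintype.piFinset (fun _ : Fin n => Finset.range (modS S m)) : Set (Fin n → ℕ))
      (fun b => ballS n S (fun i => (b i : ℤ)) m) := by
    intro b hb b' hb' hne
    simp only [Function.onFun]
    rw [Set.disjoint_left]
    intro g hg hg'
    apply hne
    funext i
    have h1 : ∀ q : S, (((q.1 : ℕ) : ℤ_[(q.1 : ℕ)])) ^ m ∣ (((b' i : ℤ) - (b i : ℤ) : ℤ) : ℤ_[(q.1 : ℕ)]) := by
      intro q
      have := dvd_sub (hg q i) (hg' q i)
      rw [sub_sub_sub_cancel_left] at this
      rw [Int.cast_sub]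
      exact this
    rw [modS_dvd, ← Nat.modEq_iff_dvd] at h1
    simp at hb hb'
    exact h1.eq_of_lt_of_lt (hb i) (hb' i)
  have hsum := measureReal_biUnion_finset (μ := ν) hdis
    (fun b _ => (isOpen_ballS n S _ m).measurableSet)
  rw [hcov] at hsum
  simp only [htr] at hsum
  have hp : (0 : ℝ) < modS S m := by exact_mod_cast modS_pos S m
  rw [htr]
  simp at hsum
  push_cast
  rw [one_div, inv_pow]
  field_simp
  linarith

def boxFin0 (n : ℕ) (k : Fin n → ℕ) (c : Fin n → ℝ) (X : ℝ) : Finset (Fin n → ℤ) :=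
  insert 0 (boxFin n k c X)

lemma boxFin0_eq (n : ℕ) (k : Fin n → ℕ) (c : Fin n → ℝ) (hc : ∀ i, 0 < c i) (X : ℝ) (hX : 0 < X) :
    boxFin0 n k c X = boxFin n k c X := by
  refine Finset.insert_eq_of_mem ?_
  rw [← Finset.mem_coe, coe_boxFin]
  intro i
  simp only [Pi.zero_apply, Int.cast_zero, abs_zero]
  exact (Real.rpow_pos_of_pos (mul_pos (hc i) hX) _).le

def empS (n : ℕ) (k : Fin n → ℕ) (c : Fin n → ℝ) (S : Finset Nat.Primes) (X : ℝ) :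
    ProbabilityMeasure (GS n S) :=
  ⟨Measure.map (iotaS n S) (ProbabilityTheory.uniformOn (boxFin0 n k c X : Set (Fin n → ℤ))), by
    have : IsProbabilityMeasure
        (ProbabilityTheory.uniformOn (boxFin0 n k c X : Set (Fin n → ℤ))) :=
      ProbabilityTheory.isProbabilityMeasure_uniformOn (Finset.finite_toSet _)
        ⟨0, by simp [boxFin0]⟩
    exact Measure.isProbabilityMeasure_map (measurable_of_countable _).aemeasurable⟩

open Classical in
lemma empS_apply (n : ℕ) (k : Fin n → ℕ) (c : Fin n → ℝ) (hc : ∀ i, 0 < c i)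
    (S : Finset Nat.Primes) (X : ℝ) (hX : 0 < X) (E : Set (GS n S)) :
    ((empS n k c S X E : NNReal) : ℝ) =
      (((boxFin n k c X).filter (fun x => iotaS n S x ∈ E)).card : ℝ) / (boxFin n k c X).card := by
  have h1 : ((empS n k c S X E : NNReal) : ℝ) = (Measure.map (iotaS n S)
    (ProbabilityTheory.uniformOn (boxFin0 n k c X : Set (Fin n → ℤ)))).real E := rfl
  have hE : NullMeasurableSet E (Measure.map (iotaS n S)
      (ProbabilityTheory.uniformOn (boxFin0 n k c X : Set (Fin n → ℤ)))) := by
    have hfin : (iotaS n S '' (boxFin0 n k c X : Set (Fin n → ℤ))).Finite :=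
      (Finset.finite_toSet _).image _
    refine ⟨E ∩ iotaS n S '' (boxFin0 n k c X : Set (Fin n → ℤ)),
      (hfin.subset Set.inter_subset_right).measurableSet, ?_⟩
    have h0 : ∀ᵐ g ∂(Measure.map (iotaS n S)
      (ProbabilityTheory.uniformOn (boxFin0 n k c X : Set (Fin n → ℤ)))),
        g ∈ iotaS n S '' (boxFin0 n k c X : Set (Fin n → ℤ)) := by
      refine (ae_map_iff (p := fun g => g ∈ iotaS n S '' (boxFin0 n k c X : Set (Fin n → ℤ)))
        (measurable_of_countable _).aemeasurable hfin.measurableSet).2 ?_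
      rw [ProbabilityTheory.uniformOn]
      filter_upwards [ProbabilityTheory.ae_cond_mem (Finset.measurableSet _)] with x hx
      exact ⟨x, hx, rfl⟩
    filter_upwards [h0] with g hg
    exact propext ⟨fun h => ⟨h, hg⟩, fun h => h.1⟩
  rw [h1, measureReal_def, Measure.map_apply₀ (measurable_of_countable _).aemeasurable hE,
    ProbabilityTheory.uniformOn, ProbabilityTheory.cond_apply (Finset.measurableSet _),
    boxFin0_eq n k c hc X hX]
  have h2 : ((boxFin n k c X : Finset (Fin n → ℤ)) : Set (Fin n → ℤ)) ∩ iotaS n S ⁻¹' E =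
      (((boxFin n k c X).filter (fun x => iotaS n S x ∈ E) : Finset (Fin n → ℤ)) : Set (Fin n → ℤ)) := by
    ext x; simp
  rw [h2, Measure.count_apply_finset, Measure.count_apply_finset]
  simp [div_eq_inv_mul]

lemma countall (n : ℕ) (k : Fin n → ℕ) (hk : ∀ i, 1 ≤ k i) (c : Fin n → ℝ) (hc : ∀ i, 0 < c i) :
    Tendsto (fun X : ℝ => ((boxFin n k c X).card : ℝ) / boxVol n k c X) atTop (𝓝 1) := by
  have := countbox n k hk c hc 0 1 one_pos
  simpa [Int.modEq_one] using this

def limS (n : ℕ) (S : Finset Nat.Primes) (μ : (p : Nat.Primes) → Measure (Fin n → ℤ_[p]))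
    (hμprob : ∀ p, IsProbabilityMeasure (μ p)) : ProbabilityMeasure (GS n S) :=
  ⟨Measure.pi (fun q : S => μ q.1), inferInstance⟩

lemma weakS (n : ℕ) (k : Fin n → ℕ) (hk : ∀ i, 1 ≤ k i) (c : Fin n → ℝ) (hc : ∀ i, 0 < c i)
    (S : Finset Nat.Primes) (μ : (p : Nat.Primes) → Measure (Fin n → ℤ_[p]))
    (hμ : ∀ p, (μ p).IsAddHaarMeasure) (hμprob : ∀ p, IsProbabilityMeasure (μ p)) :
    Tendsto (empS n k c S) atTop
      (𝓝 (limS n S μ hμprob)) := by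
  classical
  refine IsPiSystem.tendsto_probabilityMeasure_of_tendsto_of_mem (piSystemS n S) ?_
    (fun u hu x hx => smallS n S u hu x hx) ?_
  · rintro _ ⟨a, m, rfl⟩
    exact (isOpen_ballS n S a m).measurableSet
  · rintro _ ⟨a, m, rfl⟩
    rw [← NNReal.tendsto_coe]
    have h1 : (((limS n S μ hμprob)
      (ballS n S a m) : NNReal) : ℝ) = (1 / ((modS S m : ℤ) : ℝ)) ^ n :=
      measure_ballS n S μ hμ hμprob a m
    rw [h1]
    have h2 := (countbox n k hk c hc a (modS S m) (by exact_mod_cast modS_pos S m)).div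
      (countall n k hk c hc) one_ne_zero
    rw [div_one] at h2
    refine h2.congr' ?_
    filter_upwards [eventually_gt_atTop 0] with X hX
    rw [empS_apply n k c hc S X hX]
    have hv := boxVol_pos n k c hc X hX
    simp only [Pi.div_apply]
    rw [div_div_div_cancel_right₀ hv.ne']
    simp only [iota_mem_ball]

lemma densS (n : ℕ) (k : Fin n → ℕ) (hk : ∀ i, 1 ≤ k i) (c : Fin n → ℝ) (hc : ∀ i, 0 < c i)
    (S : Finset Nat.Primes) (μ : (p : Nat.Primes) → Measure (Fin n → ℤ_[p]))
    (hμ : ∀ p, (μ p).IsAddHaarMeasure) (hμprob : ∀ p, IsProbabilityMeasure (μ p))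
    (E : (p : Nat.Primes) → Set (Fin n → ℤ_[p])) 
    (hEf : ∀ p, μ p (frontier (E p)) = 0) :
    Tendsto (fun X : ℝ => (({x ∈ latticeBox n k c X | ∀ q ∈ S, padicEmbed n q x ∈ E q}).ncard : ℝ)
      / boxVol n k c X) atTop (𝓝 (∏ q ∈ S, (μ q).real (E q))) := by
  classical
  set F : Set (GS n S) := Set.univ.pi (fun q : S => E q.1) with hF
  have hFf : Measure.pi (fun q : S => μ q.1) (frontier F) = 0 := by
    have hsub : frontier F ⊆ ⋃ q : S, Function.eval q ⁻¹' frontier (E q.1) := by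
      intro g hg
      by_contra hcon
      simp only [Set.mem_iUnion, not_exists, Set.mem_preimage, Function.eval] at hcon
      rw [frontier, hF, closure_pi_set, interior_pi_set Set.finite_univ] at hg
      obtain ⟨h1, h2⟩ := hg
      apply h2
      intro q _
      by_contra h3
      exact hcon q ⟨h1 q trivial, h3⟩
    refine measure_mono_null hsub (measure_iUnion_null fun q => ?_)
    rw [(measurePreserving_eval (fun q : S => μ q.1) q).measure_preimage
      isClosed_frontier.measurableSet.nullMeasurableSet]
    exact hEf q.1
  have h1 := ProbabilityMeasure.tendsto_measure_of_null_frontier_of_tendsto'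
    (weakS n k hk c hc S μ hμ hμprob) (E := F) hFf
  have h2 := (ENNReal.tendsto_toReal (measure_ne_top _ _)).comp h1
  have h3 : (Measure.pi (fun q : S => μ q.1) F).toReal = ∏ q ∈ S, (μ q).real (E q) := by
    rw [hF, Measure.pi_pi, ENNReal.toReal_prod, ← Finset.prod_coe_sort S]
    rfl
  have h4 : Tendsto (fun X => ((empS n k c S X F : NNReal) : ℝ)) atTop
      (𝓝 (∏ q ∈ S, (μ q).real (E q))) := by
    rw [← h3]; exact h2
  have h5 := h4.mul (countall n k hk c hc)
  rw [mul_one] at h5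
  refine h5.congr' ?_
  have hpos := (countall n k hk c hc).eventually (lt_mem_nhds one_pos)
  filter_upwards [eventually_gt_atTop 0, hpos] with X hX hcp
  rw [empS_apply n k c hc S X hX F]
  have hv := boxVol_pos n k c hc X hX
  have hc0 : (0 : ℝ) < (boxFin n k c X).card := by
    by_contra h
    have : ((boxFin n k c X).card : ℝ) = 0 := le_antisymm (not_lt.1 h) (Nat.cast_nonneg _)
    rw [this, zero_div] at hcp
    exact lt_irrefl _ hcp
  have h6 : {x ∈ latticeBox n k c X | ∀ q ∈ S, padicEmbed n q x ∈ E q} =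
      (((boxFin n k c X).filter (fun x => iotaS n S x ∈ F) : Finset (Fin n → ℤ)) :
        Set (Fin n → ℤ)) := by
    ext x
    simp only [Set.mem_ofPred_eq, Finset.coe_filter, ← coe_boxFin, Finset.mem_coe, hF,
      Set.mem_univ_pi, iotaS, Subtype.forall]
  rw [h6, Set.ncard_coe_finset]
  field_simp

lemma tendsto_prod_Icc {ι : Type*} (f : ι → ℝ) (h0 : ∀ i, 0 ≤ f i) (h1 : ∀ i, f i ≤ 1) :
    Tendsto (fun s : Finset ι => ∏ i ∈ s, f i) atTop (𝓝 (∏' i, f i)) := by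
  classical
  have hanti : Antitone (fun s : Finset ι => ∏ i ∈ s, f i) := by
    intro s t hst
    simp only
    rw [← Finset.prod_sdiff hst]
    exact mul_le_of_le_one_left (Finset.prod_nonneg fun i _ => h0 i)
      (Finset.prod_le_one (fun i _ => h0 i) (fun i _ => h1 i))
  have hbdd : BddBelow (Set.range (fun s : Finset ι => ∏ i ∈ s, f i)) :=
    ⟨0, by rintro _ ⟨s, rfl⟩; exact Finset.prod_nonneg fun i _ => h0 i⟩
  have h := tendsto_atTop_ciInf hanti hbdd
  have hp : HasProd f (⨅ s : Finset ι, ∏ i ∈ s, f i) := by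
    rw [HasProd, SummationFilter.unconditional_filter]
    exact h
  rw [hp.tprod_eq]
  exact h

lemma mainE (n : ℕ)
    (k : Fin n → ℕ) (hk : ∀ i, 1 ≤ k i)
    (c : Fin n → ℝ) (hc : ∀ i, 0 < c i)
    (U : (p : Nat.Primes) → Set (Fin n → ℤ_[p]))
    (μ : (p : Nat.Primes) → Measure (Fin n → ℤ_[p]))
    (hμ : ∀ p, (μ p).IsAddHaarMeasure) (hμprob : ∀ p, IsProbabilityMeasure (μ p))
    (hUmeas : ∀ p, MeasurableSet (U p))
    (hUbd : ∀ p, μ p (frontier (U p)) = 0)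
    (hEk : EkedahlAdmissible n k c U)
    (p : Nat.Primes) (hp : 0 < 1 - (μ p (U p)).toReal)
    (E : Set (Fin n → ℤ_[p])) (hEf : μ p (frontier E) = 0) :
    Tendsto (fun X : ℝ => (({x ∈ sievedBox n k c U X | padicEmbed n p x ∈ E}).ncard : ℝ)
      / boxVol n k c X) atTop (𝓝 ((μ p).real (E ∩ (U p)ᶜ) / (1 - (μ p (U p)).toReal) *
        ∏' q : Nat.Primes, (1 - (μ q (U q)).toReal))) := by
  classical
  set r := (μ p).real (E ∩ (U p)ᶜ) / (1 - (μ p (U p)).toReal) with hr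
  set T := ∏' q : Nat.Primes, (1 - (μ q (U q)).toReal) with hT
  have hcompl : ∀ q, (μ q).real (U q)ᶜ = 1 - (μ q (U q)).toReal := fun q =>
    probReal_compl_eq_one_sub (hUmeas q)
  let E' : (q : Nat.Primes) → Set (Fin n → ℤ_[q]) :=
    Function.update (fun q => (U q)ᶜ) p (E ∩ (U p)ᶜ)
  have hE'p : E' p = E ∩ (U p)ᶜ := by simp [E']
  have hE'q : ∀ q, q ≠ p → E' q = (U q)ᶜ := fun q hq => by simp [E', hq]
  have hE'f : ∀ q, μ q (frontier (E' q)) = 0 := by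
    intro q
    by_cases hq : q = p
    · subst hq
      rw [hE'p]
      exact null_frontier_inter hEf (by rw [frontier_compl]; exact hUbd q)
    · rw [hE'q q hq, frontier_compl]; exact hUbd q
  have hprod : ∀ S : Finset Nat.Primes, p ∈ S →
      ∏ q ∈ S, (μ q).real (E' q) = r * ∏ q ∈ S, (1 - (μ q (U q)).toReal) := by
    intro S hS
    rw [← Finset.mul_prod_erase S _ hS,
      ← Finset.mul_prod_erase S (fun q => (1 - (μ q (U q)).toReal)) hS, hE'p, ← mul_assoc, hr,
      div_mul_cancel₀ _ hp.ne']
    congr 1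
    refine Finset.prod_congr rfl fun q hq => ?_
    rw [hE'q q (Finset.ne_of_mem_erase hq), hcompl]
  have hlim : Tendsto (fun S : Finset Nat.Primes => r * ∏ q ∈ S, (1 - (μ q (U q)).toReal)) atTop
      (𝓝 (r * T)) := by
    refine (tendsto_prod_Icc _ (fun q => ?_) (fun q => ?_)).const_mul r
    · rw [← hcompl]; exact measureReal_nonneg
    · rw [← hcompl]; exact measureReal_le_one
  have hfinbox : ∀ X, (latticeBox n k c X).Finite := fun X => by
    rw [← coe_boxFin]; exact Finset.finite_toSet _
  rw [Metric.tendsto_atTop']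
  intro ε hε
  -- choose Y
  have hY := (hEk.eventually (gt_mem_nhds (by linarith : (0 : ℝ) < ε / 3)))
  obtain ⟨Y, hY⟩ := hY.exists
  have hbd : IsBoundedUnder (· ≤ ·) atTop (fun X : ℝ =>
        (({x ∈ latticeBox n k c X |
            ∃ p : Nat.Primes, Y < (p : ℕ) ∧ padicEmbed n p x ∈ U p}).ncard : ℝ)
          / boxVol n k c X) := by
    refine (countall n k hk c hc).isBoundedUnder_le.mono_le ?_
    filter_upwards [eventually_gt_atTop 0] with X hX
    refine div_le_div_of_nonneg_right ?_ (boxVol_pos n k c hc X hX).le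
    rw [← Set.ncard_coe_finset, coe_boxFin]
    exact_mod_cast Set.ncard_le_ncard (Set.sep_subset _ _) (hfinbox X)
  have hev1 := eventually_lt_of_limsup_lt hY hbd
  -- choose S
  have hYfin : {q : Nat.Primes | ((q : ℕ) : ℝ) ≤ Y}.Finite := by
    refine Set.Finite.of_injOn (f := fun q : Nat.Primes => (q : ℕ)) (t := Set.Iic ⌊Y⌋₊) ?_ ?_
      (Set.finite_Iic _)
    · intro q hq
      exact Nat.le_floor hq
    · intro a _ b _ hab
      exact Subtype.ext hab
  obtain ⟨S, hS1, hS2⟩ := ((hlim.eventually (Metric.ball_mem_nhds _ (by linarith : (0 : ℝ) < ε / 3))).and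
    (eventually_ge_atTop (insert p hYfin.toFinset))).exists
  have hpS : p ∈ S := hS2 (Finset.mem_insert_self _ _)
  have hqS : ∀ q : Nat.Primes, ((q : ℕ) : ℝ) ≤ Y → q ∈ S := fun q hq =>
    hS2 (Finset.mem_insert_of_mem (by simpa using hq))
  have hD := densS n k hk c hc S μ hμ hμprob E' hE'f
  rw [hprod S hpS] at hD
  have hev2 := hD.eventually (Metric.ball_mem_nhds _ (by linarith : (0 : ℝ) < ε / 3))
  obtain ⟨X0, hX0⟩ := eventually_atTop.1 ((hev1.and hev2).and (eventually_gt_atTop 0))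
  refine ⟨X0, fun X hX => ?_⟩
  obtain ⟨⟨h1, h2⟩, h3⟩ := hX0 X hX.le
  have hv := boxVol_pos n k c hc X h3
  set A : Set (Fin n → ℤ) := {x ∈ sievedBox n k c U X | padicEmbed n p x ∈ E} with hA
  set B : Set (Fin n → ℤ) := {x ∈ latticeBox n k c X | ∀ q ∈ S, padicEmbed n q x ∈ E' q} with hB
  set C : Set (Fin n → ℤ) := {x ∈ latticeBox n k c X |
            ∃ p : Nat.Primes, Y < (p : ℕ) ∧ padicEmbed n p x ∈ U p} with hC
  have hAB : A ⊆ B := by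
    rintro x ⟨⟨hx1, hx2⟩, hx3⟩
    refine ⟨hx1, fun q _ => ?_⟩
    by_cases hq : q = p
    · subst hq; rw [hE'p]; exact ⟨hx3, hx2 q⟩
    · rw [hE'q q hq]; exact hx2 q
  have hBAC : B ⊆ A ∪ C := by
    rintro x ⟨hx1, hx2⟩
    by_cases hx3 : ∃ p : Nat.Primes, Y < (p : ℕ) ∧ padicEmbed n p x ∈ U p
    · exact Or.inr ⟨hx1, hx3⟩
    · push Not at hx3
      have hxp := hx2 p hpS
      rw [hE'p] at hxp
      refine Or.inl ⟨⟨hx1, fun q => ?_⟩, hxp.1⟩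
      by_cases hqY : Y < (q : ℕ)
      · exact hx3 q hqY
      · have hxq := hx2 q (hqS q (not_lt.1 hqY))
        by_cases hq : q = p
        · subst hq; exact hxp.2
        · rw [hE'q q hq] at hxq; exact hxq
  have hBf : B.Finite := (hfinbox X).subset (Set.sep_subset _ _)
  have hCf : C.Finite := (hfinbox X).subset (Set.sep_subset _ _)
  have hAf : A.Finite := hBf.subset hAB
  have n1 : (A.ncard : ℝ) / boxVol n k c X ≤ (B.ncard : ℝ) / boxVol n k c X := by
    refine div_le_div_of_nonneg_right ?_ hv.le
    exact_mod_cast Set.ncard_le_ncard hAB hBf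
  have n2 : (B.ncard : ℝ) / boxVol n k c X ≤
      (A.ncard : ℝ) / boxVol n k c X + (C.ncard : ℝ) / boxVol n k c X := by
    rw [← add_div]
    refine div_le_div_of_nonneg_right ?_ hv.le
    exact_mod_cast (Set.ncard_le_ncard hBAC (hAf.union hCf)).trans (Set.ncard_union_le _ _)
  rw [Real.dist_eq, abs_lt] at h2 hS1
  obtain ⟨a1, a2⟩ := h2
  obtain ⟨b1, b2⟩ := hS1
  rw [Real.dist_eq, abs_lt]
  constructor <;> linarith

lemma frontier_subset_of_loc {α : Type*} [TopologicalSpace α] (φ : α → ℝ) (Z : Set α)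
    (hZ : IsClosed Z) (h : IsLocallyConstant (fun x : (Zᶜ : Set α) => φ x.1)) (A : Set ℝ) :
    frontier (φ ⁻¹' A) ⊆ Z := by
  intro x hx
  by_contra hxZ
  have h1 := h.eventually_eq ⟨x, hxZ⟩
  have h2 : ∀ᶠ y in 𝓝 x, φ y = φ x := by
    rw [← hZ.isOpen_compl.isOpenEmbedding_subtypeVal.map_nhds_eq ⟨x, hxZ⟩]
    exact h1
  rw [frontier_eq_closure_inter_closure] at hx
  obtain ⟨c1, c2⟩ := hx
  rw [mem_closure_iff_frequently] at c1 c2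
  obtain ⟨y, hy, hy'⟩ := (c1.and_eventually h2).exists
  obtain ⟨z, hz, hz'⟩ := (c2.and_eventually h2).exists
  apply hz
  have : φ y ∈ A := hy
  show φ z ∈ A
  rw [hz', ← hy']; exact this

/-- The average of a single bounded, almost-everywhere locally constant `p`-adic function over
the sieved set `V^𝒰_{k,c}(X)` converges, as `X → ∞`, to its `p`-adic average over `ℤ_p^n ∖ 𝒰_p`. -/
theorem average_fixed_prime (n : ℕ) (hn : 1 ≤ n)
    (k : Fin n → ℕ) (hk : ∀ i, 1 ≤ k i)
    (c : Fin n → ℝ) (hc : ∀ i, 0 < c i)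
    (U : (p : Nat.Primes) → Set (Fin n → ℤ_[p]))
    (μ : (p : Nat.Primes) → Measure (Fin n → ℤ_[p]))
    (hμ : ∀ p, (μ p).IsAddHaarMeasure) (hμprob : ∀ p, IsProbabilityMeasure (μ p))
    (hUmeas : ∀ p, MeasurableSet (U p))
    (hUbd : ∀ p, μ p (frontier (U p)) = 0)
    (hEk : EkedahlAdmissible n k c U)
    (hpos : 0 < ∏' q : Nat.Primes, (1 - (μ q (U q)).toReal))
    (p : Nat.Primes) (φ : (Fin n → ℤ_[p]) → ℝ)
    (hbdd : ∃ C : ℝ, ∀ x, |φ x| ≤ C)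
    (hloc : ∃ Z : Set (Fin n → ℤ_[p]), IsClosed Z ∧ μ p Z = 0 ∧
      IsLocallyConstant (fun x : (Zᶜ : Set (Fin n → ℤ_[p])) => φ x.1)) :
    Tendsto (fun X : ℝ =>
        (∑ᶠ x ∈ sievedBox n k c U X, φ (padicEmbed n p x)) / ((sievedBox n k c U X).ncard : ℝ))
      atTop
      (𝓝 ((∫ x in (U p)ᶜ, φ x ∂(μ p)) / (1 - (μ p (U p)).toReal))) := by
  classical
  obtain ⟨C, hC⟩ := hbdd
  obtain ⟨Z, hZc, hZ0, hZl⟩ := hloc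
  have hnull : ∀ A : Set ℝ, μ p (frontier (φ ⁻¹' A)) = 0 := fun A =>
    measure_mono_null (frontier_subset_of_loc φ Z hZc hZl A) hZ0
  have hnm : ∀ A : Set ℝ, NullMeasurableSet (φ ⁻¹' A) (μ p) := fun A =>
    nullMeasurableSet_of_null_frontier (hnull A)
  have haem : AEMeasurable φ (μ p) := NullMeasurable.aemeasurable (fun A _ => hnm A)
  have hcompl : ∀ q, (μ q).real (U q)ᶜ = 1 - (μ q (U q)).toReal := fun q =>
    probReal_compl_eq_one_sub (hUmeas q)
  have h01 : ∀ q, 0 ≤ 1 - (μ q (U q)).toReal ∧ 1 - (μ q (U q)).toReal ≤ 1 := fun q => by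
    rw [← hcompl]; exact ⟨measureReal_nonneg, measureReal_le_one⟩
  -- positivity of the local factor
  have hp : 0 < 1 - (μ p (U p)).toReal := by
    refine lt_of_le_of_ne (h01 p).1 fun h => ?_
    have h1 := tendsto_prod_Icc (fun q : Nat.Primes => 1 - (μ q (U q)).toReal)
      (fun q => (h01 q).1) (fun q => (h01 q).2)
    have h2 : Tendsto (fun s : Finset Nat.Primes => ∏ q ∈ s, (1 - (μ q (U q)).toReal)) atTop
        (𝓝 0) := by
      refine tendsto_const_nhds.congr' ?_
      filter_upwards [eventually_ge_atTop {p}] with s hs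
      exact (Finset.prod_eq_zero (hs (Finset.mem_singleton_self p)) h.symm).symm
    rw [tendsto_nhds_unique h1 h2] at hpos
    exact lt_irrefl _ hpos
  set T := ∏' q : Nat.Primes, (1 - (μ q (U q)).toReal) with hT
  set w := 1 - (μ p (U p)).toReal with hw
  have hmain := fun E hE => mainE n k hk c hc U μ hμ hμprob hUmeas hUbd hEk p hp E hE
  -- relative densities
  have huniv : Tendsto (fun X : ℝ => ((sievedBox n k c U X).ncard : ℝ) / boxVol n k c X) atTop
      (𝓝 T) := by
    have := hmain Set.univ (by simp)
    rw [Set.univ_inter, hcompl, div_self hp.ne', one_mul] at this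
    simpa using this
  have hsf : ∀ X, (sievedBox n k c U X).Finite := fun X => by
    have : (latticeBox n k c X).Finite := by
      rw [← coe_boxFin]; exact Finset.finite_toSet _
    exact this.subset fun x hx => hx.1
  have hN : ∀ᶠ X in atTop, (0 : ℝ) < (sievedBox n k c U X).ncard := by
    filter_upwards [huniv.eventually (lt_mem_nhds hpos), eventually_gt_atTop 0] with X h1 h2
    have hv := boxVol_pos n k c hc X h2
    exact (div_pos_iff_of_pos_right hv).1 h1
  have hrel : ∀ A : Set ℝ, Tendsto (fun X : ℝ =>
      (({x ∈ sievedBox n k c U X | padicEmbed n p x ∈ φ ⁻¹' A}).ncard : ℝ)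
        / (sievedBox n k c U X).ncard) atTop (𝓝 ((μ p).real (φ ⁻¹' A ∩ (U p)ᶜ) / w)) := by
    intro A
    have h1 := (hmain (φ ⁻¹' A) (hnull A)).div huniv hpos.ne'
    rw [mul_div_cancel_right₀ _ hpos.ne'] at h1
    refine h1.congr' ?_
    filter_upwards [eventually_gt_atTop 0] with X h2
    have hv := boxVol_pos n k c hc X h2
    simp only [Pi.div_apply]
    rw [div_div_div_cancel_right₀ hv.ne']
  have hfs : ∀ (g : (Fin n → ℤ) → ℝ) X, ∑ᶠ x ∈ sievedBox n k c U X, g x =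
      ∑ x ∈ (hsf X).toFinset, g x := fun g X => finsum_mem_eq_finite_toFinset_sum g (hsf X)
  have hcard : ∀ X, (sievedBox n k c U X).ncard = (hsf X).toFinset.card := fun X =>
    Set.ncard_eq_toFinset_card _ (hsf X)
  rw [Metric.tendsto_atTop']
  intro ε hε
  obtain ⟨m, hm⟩ := exists_nat_gt (3 / ε)
  have hm0 : (0 : ℝ) < m := lt_trans (by positivity) hm
  have hmε : 1 / (m : ℝ) < ε / 3 := by
    rw [div_lt_iff₀ hε] at hm
    rw [div_lt_div_iff₀ hm0 (by norm_num)]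
    linarith
  -- the step function
  let J : Finset ℤ := Finset.Icc ⌊-(m * C)⌋ ⌊m * C⌋
  let A : ℤ → Set ℝ := fun j => {t | ⌊m * t⌋ = j}
  let ψ : (Fin n → ℤ_[p]) → ℝ := fun x => (⌊m * φ x⌋ : ℝ) / m
  have hψ1 : ∀ x, |φ x - ψ x| ≤ 1 / m := by
    intro x
    have e1 := Int.floor_le (m * φ x)
    have e2 := Int.lt_floor_add_one (m * φ x)
    have e3 : φ x - ψ x = (m * φ x - ⌊m * φ x⌋) / m := by
      simp only [ψ]; field_simp
    rw [e3, abs_div, abs_of_pos hm0]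
    refine div_le_div_of_nonneg_right ?_ hm0.le
    rw [abs_le]; constructor <;> linarith
  have hψ2 : ∀ x, ψ x = ∑ j ∈ J, (φ ⁻¹' A j).indicator (fun _ => (j : ℝ) / m) x := by
    intro x
    have hmem : ⌊m * φ x⌋ ∈ J := by
      have := abs_le.1 (hC x)
      refine Finset.mem_Icc.2 ⟨Int.floor_le_floor ?_, Int.floor_le_floor ?_⟩
      · nlinarith [this.1]
      · nlinarith [this.2]
    rw [Finset.sum_eq_single_of_mem _ hmem]
    · rw [Set.indicator_of_mem]
      simp [A]
    · intro j _ hj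
      rw [Set.indicator_of_notMem]
      simp only [A, Set.mem_preimage, Set.mem_ofPred_eq]
      exact fun h => hj h.symm
  have hψlim : Tendsto (fun X : ℝ => (∑ᶠ x ∈ sievedBox n k c U X, ψ (padicEmbed n p x)) /
      ((sievedBox n k c U X).ncard : ℝ)) atTop (𝓝 ((∫ x in (U p)ᶜ, ψ x ∂(μ p)) / w)) := by
    have hint : (∫ x in (U p)ᶜ, ψ x ∂(μ p)) / w =
        ∑ j ∈ J, ((j : ℝ) / m) * ((μ p).real (φ ⁻¹' A j ∩ (U p)ᶜ) / w) := by
      simp_rw [hψ2]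
      have hnm' : ∀ j, NullMeasurableSet (φ ⁻¹' A j) ((μ p).restrict (U p)ᶜ) := fun j =>
        (hnm (A j)).mono_ac Measure.restrict_le_self.absolutelyContinuous
      rw [integral_finsetSum, Finset.sum_div]
      · refine Finset.sum_congr rfl fun j _ => ?_
        rw [integral_indicator₀ (hnm' j), setIntegral_const, measureReal_def,
          Measure.restrict_apply₀ (hnm' j), smul_eq_mul, measureReal_def]
        ring
      · intro j _
        exact (integrable_const _).indicator₀ (hnm' j)
    rw [hint]
    have hsum := tendsto_finsetSum J fun j _ => (hrel (A j)).const_mul ((j : ℝ) / m)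
    refine hsum.congr fun X => ?_
    rw [hfs (fun x => ψ (padicEmbed n p x))]
    simp_rw [hψ2]
    rw [Finset.sum_comm, Finset.sum_div]
    refine Finset.sum_congr rfl fun j _ => ?_
    rw [← mul_div_assoc]
    congr 1
    have e : {x ∈ sievedBox n k c U X | padicEmbed n p x ∈ φ ⁻¹' A j} =
        (((hsf X).toFinset.filter (fun x => padicEmbed n p x ∈ φ ⁻¹' A j) : Finset (Fin n → ℤ)) :
          Set (Fin n → ℤ)) := by
      ext x; simp
    rw [e, Set.ncard_coe_finset]
    simp only [Set.indicator_apply]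
    rw [← Finset.sum_filter, Finset.sum_const, nsmul_eq_mul, mul_comm]
  have hφint : Integrable φ ((μ p).restrict (U p)ᶜ) :=
    (Integrable.of_bound haem.aestronglyMeasurable C (Eventually.of_forall hC)).restrict
  have hψm : AEMeasurable ψ (μ p) := by
    have : Measurable (fun t : ℝ => (⌊m * t⌋ : ℝ) / m) := by fun_prop
    exact this.comp_aemeasurable haem
  have hψint : Integrable ψ ((μ p).restrict (U p)ᶜ) := by
    refine (Integrable.of_bound hψm.aestronglyMeasurable (C + 1 / m)
      (Eventually.of_forall fun x => ?_)).restrict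
    have a1 := abs_le.1 (hC x)
    have a2 := abs_le.1 (hψ1 x)
    rw [Real.norm_eq_abs, abs_le]
    constructor <;> linarith
  have hI : |(∫ x in (U p)ᶜ, φ x ∂(μ p)) / w - (∫ x in (U p)ᶜ, ψ x ∂(μ p)) / w| ≤ 1 / m := by
    rw [← sub_div, ← integral_sub hφint hψint, abs_div, abs_of_pos hp, div_le_iff₀ hp]
    have := norm_integral_le_of_norm_le_const (μ := (μ p).restrict (U p)ᶜ)
      (f := fun x => φ x - ψ x) (C := 1 / (m : ℝ)) (Eventually.of_forall hψ1)
    rw [measureReal_restrict_apply_univ, hcompl] at this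
    exact this
  have hev := hψlim.eventually (Metric.ball_mem_nhds _ (by linarith : (0 : ℝ) < ε / 3))
  obtain ⟨X0, hX0⟩ := eventually_atTop.1 (hev.and hN)
  refine ⟨X0, fun X hX => ?_⟩
  obtain ⟨h1, h2⟩ := hX0 X hX.le
  have hav : |(∑ᶠ x ∈ sievedBox n k c U X, φ (padicEmbed n p x)) /
      ((sievedBox n k c U X).ncard : ℝ) - (∑ᶠ x ∈ sievedBox n k c U X, ψ (padicEmbed n p x)) /
      ((sievedBox n k c U X).ncard : ℝ)| ≤ 1 / m := by
    rw [hfs (fun x => ψ (padicEmbed n p x)), hfs (fun x => φ (padicEmbed n p x)), ← sub_div,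
      ← Finset.sum_sub_distrib, abs_div, abs_of_pos h2, div_le_iff₀ h2]
    refine (Finset.abs_sum_le_sum_abs _ _).trans ?_
    refine (Finset.sum_le_card_nsmul _ _ (1 / (m : ℝ)) fun x _ => hψ1 _).trans ?_
    rw [hcard, nsmul_eq_mul, mul_comm]
  rw [Real.dist_eq, abs_lt] at h1
  rw [Real.dist_eq, abs_lt]
  rw [abs_le] at hI hav
  constructor <;> linarith [h1.1, h1.2, hI.1, hI.2, hav.1, hav.2]

end
end

section
/- Let p \ge 5 be a prime, n > 0 an integer, and let each of R_1, R_2 be either the set of nonzero squares in F_p^\times or the set of nonsquares in F_p^\times. Then: (i) \mu_p({(A,B) \in \mathbb{Z}_p^2 : (B \bmod p) \in R_1, v_p(4A^3+27B^2) = n, and ((4A^3+27B^2)p^{-n} \bmod p) \in R_2}) = (p-1)^2/(4p^{n+2}); and (ii) \mu_p({(A,B) \in \mathbb{Z}_p^2 : v_p(B) = 3, (Bp^{-3} \bmod p) \in R_1, v_p(4A^3+27B^2) = n+6, and ((4A^3+27B^2)p^{-(n+6)} \bmod p) \in R_2}) = (p-1)^2/(4p^{n+7}). -/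
open MeasureTheory

noncomputable section

lemma haar_scale {G : Type*} [AddCommGroup G] [TopologicalSpace G] [IsTopologicalAddGroup G]
    [CompactSpace G] [MeasurableSpace G] [BorelSpace G] (μ : Measure G)
    [μ.IsAddHaarMeasure] [IsProbabilityMeasure μ] (f : G →+ G) (hf : Topology.IsOpenEmbedding f)
    [f.range.FiniteIndex] (X : Set G) (hX : MeasurableSet X) :
    f.range.index * μ (f '' X) = μ X := by
  have h1 : (μ.comap f).IsAddHaarMeasure := Measure.IsAddHaarMeasure.comap (mH := inferInstance) μ hf
  have hC := Measure.isAddLeftInvariant_eq_smul_of_innerRegular (μ.comap f) μ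
  set C := Measure.addHaarScalarFactor (μ.comap f) μ
  have key : ∀ Y, MeasurableSet Y → μ (f '' Y) = C * μ Y := by
    intro Y hY
    have := congrArg (fun ν => ν Y) hC
    simp only [Measure.smul_apply] at this
    rw [hf.measurableEmbedding.comap_apply] at this
    rw [this]; rfl
  have h2 := key Set.univ MeasurableSet.univ
  have h3 := AddSubgroup.index_mul_measure f.range
    (by simpa using hf.measurableEmbedding.measurableSet_range) μ
  rw [AddMonoidHom.coe_range, ← Set.image_univ, h2] at h3
  simp only [measure_univ, mul_one] at h3
  rw [key X hX, ← mul_assoc, h3, one_mul]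

lemma openEmb_mul (p : ℕ) [Fact p.Prime] (k : ℕ) :
    Topology.IsOpenEmbedding (AddMonoidHom.mulLeft ((p : ℤ_[p]) ^ k)) := by
  have hp0 : (p : ℤ_[p]) ^ k ≠ 0 := pow_ne_zero _ (by exact_mod_cast (Fact.out : p.Prime).ne_zero)
  have hc : Continuous (AddMonoidHom.mulLeft ((p : ℤ_[p]) ^ k)) := by
    change Continuous fun x => (p : ℤ_[p]) ^ k * x
    fun_prop
  refine ⟨(hc.isClosedEmbedding (mul_right_injective₀ hp0)).isEmbedding, ?_⟩
  have : Set.range (AddMonoidHom.mulLeft ((p : ℤ_[p]) ^ k)) =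
      {x : ℤ_[p] | ‖x‖ < (p : ℝ) ^ (-(k : ℤ) + 1)} := by
    ext x
    rw [Set.mem_ofPred_eq, ← PadicInt.norm_le_pow_iff_norm_lt_pow_add_one,
      PadicInt.norm_le_pow_iff_mem_span_pow, Ideal.mem_span_singleton, dvd_def]
    simp [eq_comm]
  rw [this]
  exact isOpen_lt continuous_norm continuous_const

lemma index_mul (p : ℕ) [Fact p.Prime] (k : ℕ) :
    (AddMonoidHom.mulLeft ((p : ℤ_[p]) ^ k)).range.index = p ^ k := by
  have : (AddMonoidHom.mulLeft ((p : ℤ_[p]) ^ k)).range =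
      (PadicInt.toZModPow (p := p) k : ℤ_[p] →+ ZMod (p ^ k)).ker := by
    ext x
    have : x ∈ RingHom.ker (PadicInt.toZModPow (p := p) k) ↔ ∃ c, x = (p : ℤ_[p]) ^ k * c := by
      rw [PadicInt.ker_toZModPow, Ideal.mem_span_singleton, dvd_def]
    rw [RingHom.mem_ker] at this
    simp [AddMonoidHom.mem_ker, this, eq_comm]
  rw [this, AddSubgroup.index_ker, AddMonoidHom.range_eq_top_of_surjective]
  · simp
  · exact ZMod.ringHom_surjective (PadicInt.toZModPow (p := p) k)
open Classical in
lemma card_R (p : ℕ) [Fact p.Prime] (hp : 5 ≤ p) (R : Set (ZMod p)) 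
    (hR : R = {x : ZMod p | x ≠ 0 ∧ IsSquare x} ∨ R = {x : ZMod p | x ≠ 0 ∧ ¬ IsSquare x}) :
    2 * R.toFinset.card + 1 = p := by
  have hF : ringChar (ZMod p) ≠ 2 := by rw [ZMod.ringChar_zmod_n]; omega
  have hs := quadraticChar_sum_zero hF
  set Q := (Finset.univ.filter fun x : ZMod p => x ≠ 0 ∧ IsSquare x)
  set N := (Finset.univ.filter fun x : ZMod p => x ≠ 0 ∧ ¬ IsSquare x)
  have h1 : ∑ a : ZMod p, quadraticChar (ZMod p) a =
     ∑ a : ZMod p, ((if a ≠ 0 ∧ IsSquare a then (1:ℤ) else 0) - (if a ≠ 0 ∧ ¬ IsSquare a then (1:ℤ) else 0)) := by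
    apply Finset.sum_congr rfl
    intro a _
    by_cases ha : a = 0
    · simp [ha]
    by_cases hq : IsSquare a
    · simp [ha, hq, (quadraticChar_one_iff_isSquare ha).2 hq]
    · simp [ha, hq, quadraticChar_neg_one_iff_not_isSquare.2 hq]
  have h2 : ∑ a : ZMod p, ((if a ≠ 0 ∧ IsSquare a then (1:ℤ) else 0) + (if a ≠ 0 ∧ ¬ IsSquare a then (1:ℤ) else 0) + if a = 0 then 1 else 0) = p := by
    calc _ = ∑ a : ZMod p, (1:ℤ) := by
          apply Finset.sum_congr rfl
          intro a _
          by_cases ha : a = 0 <;> by_cases hq : IsSquare a <;> simp [ha, hq]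
      _ = p := by simp
  rw [h1, Finset.sum_sub_distrib] at hs
  rw [Finset.sum_add_distrib, Finset.sum_add_distrib] at h2
  simp only [Finset.sum_boole, Finset.filter_eq', Finset.mem_univ, if_true, Finset.card_singleton] at hs h2
  change (Q.card : ℤ) - N.card = 0 at hs
  change (Q.card : ℤ) + N.card + ((1:ℕ):ℤ) = p at h2
  rcases hR with rfl | rfl
  · rw [Set.toFinset_ofPred]; change 2 * Q.card + 1 = p; omega
  · rw [Set.toFinset_ofPred]; change 2 * N.card + 1 = p; omega

lemma toZMod_eq_zero_iff (p : ℕ) [Fact p.Prime] (x : ℤ_[p]) :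
    PadicInt.toZMod x = 0 ↔ (p : ℤ_[p]) ∣ x := by
  rw [← RingHom.mem_ker, PadicInt.ker_toZMod, PadicInt.maximalIdeal_eq_span_p, Ideal.mem_span_singleton]

lemma toZMod_ne_zero_iff (p : ℕ) [Fact p.Prime] (x : ℤ_[p]) :
    PadicInt.toZMod x ≠ 0 ↔ IsUnit x := by
  rw [Ne, toZMod_eq_zero_iff, ← PadicInt.norm_lt_one_iff_dvd, PadicInt.isUnit_iff]
  have := PadicInt.norm_le_one x
  grind

lemma open_toZMod (p : ℕ) [Fact p.Prime] (R : Set (ZMod p)) :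
    IsOpen ((PadicInt.toZMod : ℤ_[p] → ZMod p) ⁻¹' R) := by
  rw [Metric.isOpen_iff]
  intro x hx
  refine ⟨1, one_pos, fun y hy => ?_⟩
  rw [mem_ball_iff_norm, PadicInt.norm_lt_one_iff_dvd, ← toZMod_eq_zero_iff, map_sub, sub_eq_zero] at hy
  simpa [hy] using hx

open Classical in
lemma meas_toZMod (p : ℕ) [Fact p.Prime] (m : Measure ℤ_[p]) [m.IsAddHaarMeasure]
    [IsProbabilityMeasure m] (R : Set (ZMod p)) :
    p * m ((PadicInt.toZMod : ℤ_[p] → ZMod p) ⁻¹' R) = R.toFinset.card := by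
  have h0 : p * m ((PadicInt.toZMod : ℤ_[p] → ZMod p) ⁻¹' {0}) = 1 := by
    have hfi : (AddMonoidHom.mulLeft ((p : ℤ_[p]) ^ 1)).range.FiniteIndex := ⟨by
      rw [index_mul]; exact pow_ne_zero _ (Fact.out : p.Prime).ne_zero⟩
    have := haar_scale m _ (openEmb_mul p 1) Set.univ MeasurableSet.univ
    rw [index_mul] at this
    simp only [pow_one, measure_univ] at this
    rw [← this]
    congr 2
    ext x
    rw [Set.mem_preimage, Set.mem_singleton_iff, toZMod_eq_zero_iff, dvd_def]
    simp [eq_comm]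
  have h1 : ∀ r, m ((PadicInt.toZMod : ℤ_[p] → ZMod p) ⁻¹' {r}) = m ((PadicInt.toZMod : ℤ_[p] → ZMod p) ⁻¹' {0}) := by
    intro r
    obtain ⟨a, rfl⟩ := ZMod.ringHom_surjective (PadicInt.toZMod (p := p)) r
    rw [← measure_preimage_add m a]
    congr 1
    ext x
    simp
  have h2 : (PadicInt.toZMod : ℤ_[p] → ZMod p) ⁻¹' R = ⋃ r ∈ R.toFinset, (PadicInt.toZMod : ℤ_[p] → ZMod p) ⁻¹' {r} := by
    ext x; simp
  rw [h2, measure_biUnion_finset]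
  · simp only [h1, Finset.sum_const, nsmul_eq_mul]
    rw [mul_left_comm, h0, mul_one]
  · intro a _ b _ hab
    exact Disjoint.preimage _ (by simpa using hab)
  · intro b _
    exact (open_toZMod p _).measurableSet

lemma sq_mul_mem (p : ℕ) [Fact p.Prime] (R : Set (ZMod p))
    (hR : R = {x : ZMod p | x ≠ 0 ∧ IsSquare x} ∨ R = {x : ZMod p | x ≠ 0 ∧ ¬ IsSquare x})
    (a x : ZMod p) (ha : a ≠ 0) : a ^ 2 * x ∈ R ↔ x ∈ R := by
  have h : IsSquare (a ^ 2 * x) ↔ IsSquare x := by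
    constructor
    · rintro ⟨b, hb⟩
      refine ⟨b / a, ?_⟩
      field_simp
      linear_combination hb
    · rintro ⟨b, rfl⟩
      exact ⟨a * b, by ring⟩
  rcases hR with rfl | rfl <;> simp [h, ha]

lemma zero_notMem (p : ℕ) [Fact p.Prime] (R : Set (ZMod p))
    (hR : R = {x : ZMod p | x ≠ 0 ∧ IsSquare x} ∨ R = {x : ZMod p | x ≠ 0 ∧ ¬ IsSquare x}) :
    (0 : ZMod p) ∉ R := by
  rcases hR with rfl | rfl <;> simp

/-- `p ^ n` times the elements with residue in `R`. -/
def ResSet (p : ℕ) [Fact p.Prime] (n : ℕ) (R : Set (ZMod p)) : Set ℤ_[p] :=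
  AddMonoidHom.mulLeft ((p : ℤ_[p]) ^ n) '' ((PadicInt.toZMod : ℤ_[p] → ZMod p) ⁻¹' R)

lemma mem_ResSet (p : ℕ) [Fact p.Prime] (n : ℕ) (R : Set (ZMod p)) (x : ℤ_[p]) :
    x ∈ ResSet p n R ↔ ∃ D, x = (p : ℤ_[p]) ^ n * D ∧ PadicInt.toZMod D ∈ R := by
  simp [ResSet, and_comm, eq_comm]

lemma norm_ResSet (p : ℕ) [Fact p.Prime] (n : ℕ) (R : Set (ZMod p)) (h0 : (0 : ZMod p) ∉ R)
    (x : ℤ_[p]) (hx : x ∈ ResSet p n R) : ‖x‖ = (p : ℝ) ^ (-(n : ℤ)) := by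
  rw [mem_ResSet] at hx
  obtain ⟨D, rfl, hD⟩ := hx
  have : PadicInt.toZMod D ≠ 0 := fun h => h0 (h ▸ hD)
  rw [toZMod_ne_zero_iff, PadicInt.isUnit_iff] at this
  rw [norm_mul, this, PadicInt.norm_p_pow, mul_one]

lemma measurable_ResSet (p : ℕ) [Fact p.Prime] (n : ℕ) (R : Set (ZMod p)) :
    MeasurableSet (ResSet p n R) :=
  ((openEmb_mul p n).isOpenMap _ (open_toZMod p R)).measurableSet

/-- The set in part (i). -/
def S1 (p : ℕ) [Fact p.Prime] (n : ℕ) (R₁ R₂ : Set (ZMod p)) : Set (ℤ_[p] × ℤ_[p]) :=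
  {AB | PadicInt.toZMod AB.2 ∈ R₁ ∧ 4 * AB.1 ^ 3 + 27 * AB.2 ^ 2 ∈ ResSet p n R₂}

lemma measurable_S1 (p : ℕ) [Fact p.Prime] (n : ℕ) (R₁ R₂ : Set (ZMod p)) :
    MeasurableSet (S1 p n R₁ R₂) := by
  have h1 : MeasurableSet {AB : ℤ_[p] × ℤ_[p] | PadicInt.toZMod AB.2 ∈ R₁} :=
    ((open_toZMod p R₁).preimage continuous_snd).measurableSet
  have h2 : MeasurableSet {AB : ℤ_[p] × ℤ_[p] | 4 * AB.1 ^ 3 + 27 * AB.2 ^ 2 ∈ ResSet p n R₂} :=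
    (((openEmb_mul p n).isOpenMap _ (open_toZMod p R₂)).preimage
      (f := fun AB : ℤ_[p] × ℤ_[p] => 4 * AB.1 ^ 3 + 27 * AB.2 ^ 2) (by fun_prop)).measurableSet
  exact h1.inter h2

lemma four_ne (p : ℕ) [Fact p.Prime] (hp : 5 ≤ p) :
    (2 : ZMod p) ≠ 0 ∧ (3 : ZMod p) ≠ 0 := by
  constructor
  · intro h
    have : ((2 : ℕ) : ZMod p) = 0 := by exact_mod_cast h
    rw [ZMod.natCast_eq_zero_iff] at this
    have := Nat.le_of_dvd (by norm_num) this
    omega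
  · intro h
    have : ((3 : ℕ) : ZMod p) = 0 := by exact_mod_cast h
    rw [ZMod.natCast_eq_zero_iff] at this
    have := Nat.le_of_dvd (by norm_num) this
    omega

open Classical in
/-- The scaling on the second coordinate. -/
def gmap (p : ℕ) [Fact p.Prime] (c : ℤ_[p]) (A t : ℤ_[p]) : ℤ_[p] :=
  if IsUnit A then c * A * t else t

lemma gmap_pres (p : ℕ) [Fact p.Prime] (c : ℤ_[p]) (hc : IsUnit c) (m : Measure ℤ_[p])
    [m.IsAddHaarMeasure] [IsProbabilityMeasure m] (A : ℤ_[p]) : m.map (gmap p c A) = m := by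
  by_cases hA : IsUnit A
  · have : gmap p c A = AddMonoidHom.mulLeft (c * A) := by
      ext t; simp [gmap, hA]
    rw [this]
    refine (AddMonoidHom.measurePreserving ?_ ?_ rfl).map_eq
    · change Continuous fun x => (c * A) * x
      fun_prop
    · intro y
      obtain ⟨u, hu⟩ := hc.mul hA
      refine ⟨(u⁻¹ : (ℤ_[p])ˣ) * y, ?_⟩
      simp [← hu]
  · have : gmap p c A = id := by
      ext t; simp [gmap, hA]
    rw [this, Measure.map_id]

lemma gmap_meas (p : ℕ) [Fact p.Prime] (c : ℤ_[p]) :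
    Measurable (Function.uncurry (gmap p c)) := by
  classical
  refine Measurable.ite (p := fun x : ℤ_[p] × ℤ_[p] => IsUnit x.1)
    (f := fun x => c * x.1 * x.2) (g := fun x => x.2) ?_ ?_ ?_
  · simp only [PadicInt.isUnit_iff]
    exact (isClosed_eq (f := fun x : ℤ_[p] × ℤ_[p] => ‖x.1‖) (by fun_prop) continuous_const).measurableSet
  · exact Continuous.measurable (by fun_prop)
  · exact measurable_snd

/-- The parametrization. -/
def Psi (p : ℕ) [Fact p.Prime] (c : ℤ_[p]) (x : ℤ_[p] × ℤ_[p]) : ℤ_[p] × ℤ_[p] :=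
  (x.1 - 3 * x.2 ^ 2, gmap p c (x.1 - 3 * x.2 ^ 2) x.2)

lemma Psi_pres (p : ℕ) [Fact p.Prime] (c : ℤ_[p]) (hc : IsUnit c) (m : Measure ℤ_[p])
    [m.IsAddHaarMeasure] [IsProbabilityMeasure m] :
    MeasurePreserving (Psi p c) (m.prod m) (m.prod m) := by
  have h1 : MeasurePreserving (fun x : ℤ_[p] × ℤ_[p] => (x.1, gmap p c x.1 x.2))
      (m.prod m) (m.prod m) :=
    (MeasurePreserving.id m).skew_product (gmap_meas p c) (.of_forall fun A => gmap_pres p c hc m A)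
  have h2 : MeasurePreserving (fun x : ℤ_[p] × ℤ_[p] => (x.1, x.2 - 3 * x.1 ^ 2))
      (m.prod m) (m.prod m) := by
    refine (MeasurePreserving.id m).skew_product (g := fun t s => s - 3 * t ^ 2)
      (Continuous.measurable (by fun_prop)) (.of_forall fun A => ?_)
    exact (measurePreserving_sub_right m (3 * A ^ 2)).map_eq
  exact h1.comp ((Measure.measurePreserving_swap (μ := m) (ν := m)).comp
    (h2.comp (Measure.measurePreserving_swap (μ := m) (ν := m))))

lemma Psi_preimage (p : ℕ) [Fact p.Prime] (hp : 5 ≤ p) (c : ℤ_[p]) (hc3 : 3 * c = -2)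
    (n : ℕ) (hn : 0 < n) (R₁ R₂ : Set (ZMod p))
    (hR₁ : R₁ = {x : ZMod p | x ≠ 0 ∧ IsSquare x} ∨ R₁ = {x : ZMod p | x ≠ 0 ∧ ¬ IsSquare x})
    (hR₂ : R₂ = {x : ZMod p | x ≠ 0 ∧ IsSquare x} ∨ R₂ = {x : ZMod p | x ≠ 0 ∧ ¬ IsSquare x}) :
    Psi p c ⁻¹' S1 p n R₁ R₂ =
      ResSet p n R₂ ×ˢ ((PadicInt.toZMod : ℤ_[p] → ZMod p) ⁻¹' {x | 2 * x ∈ R₁}) := by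
  obtain ⟨n2, n3⟩ := four_ne p hp
  have z1 := zero_notMem p R₁ hR₁
  have z2 := zero_notMem p R₂ hR₂
  have zP : ∀ R x, x ∈ ResSet p n R → PadicInt.toZMod x = 0 := by
    intro R x hx
    rw [mem_ResSet] at hx
    obtain ⟨D, rfl, -⟩ := hx
    simp [hn.ne']
  ext ⟨s, t⟩
  simp only [Set.mem_preimage, Set.mem_prod, Psi, S1, Set.mem_ofPred_eq]
  have cz : (3 : ZMod p) * PadicInt.toZMod c = -2 := by
    have := congrArg (PadicInt.toZMod) hc3
    simpa only [map_mul, map_neg, map_ofNat] using this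
  -- the common part, once `A` is a unit and `s` is zero mod `p`
  have key : IsUnit (s - 3 * t ^ 2) → PadicInt.toZMod s = 0 → PadicInt.toZMod t ≠ 0 →
      (PadicInt.toZMod (gmap p c (s - 3 * t ^ 2) t) ∈ R₁ ↔ 2 * PadicInt.toZMod t ∈ R₁) := by
    intro hu hs ht
    rw [← sq_mul_mem p R₁ hR₁ _ (2 * PadicInt.toZMod t) ht]
    have : PadicInt.toZMod (gmap p c (s - 3 * t ^ 2) t) =
        PadicInt.toZMod t ^ 2 * (2 * PadicInt.toZMod t) := by
      simp only [gmap, hu, if_true, map_mul, map_sub, map_pow, hs]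
      simp only [map_ofNat]
      linear_combination (-(PadicInt.toZMod t)^3) * cz
    rw [this]
  have key2 : IsUnit (s - 3 * t ^ 2) →
      (4 * (s - 3 * t ^ 2) ^ 3 + 27 * gmap p c (s - 3 * t ^ 2) t ^ 2 ∈ ResSet p n R₂ ↔
        s ∈ ResSet p n R₂) := by
    intro hu
    have hA := (toZMod_ne_zero_iff p _).2 hu
    have e : 4 * (s - 3 * t ^ 2) ^ 3 + 27 * gmap p c (s - 3 * t ^ 2) t ^ 2 =
        (2 * (s - 3 * t ^ 2)) ^ 2 * s := by
      simp only [gmap, hu, if_true]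
      linear_combination (3 * (s - 3 * t ^ 2) ^ 2 * t ^ 2 * (3 * c - 2)) * hc3
    rw [e]
    have hv : PadicInt.toZMod (2 * (s - 3 * t ^ 2)) ≠ 0 := by
      rw [map_mul, map_ofNat]
      exact mul_ne_zero n2 hA
    generalize 2 * (s - 3 * t ^ 2) = v at hv
    rw [mem_ResSet, mem_ResSet]
    constructor
    · rintro ⟨D, hD, hDR⟩
      obtain ⟨u, rfl⟩ := (toZMod_ne_zero_iff p _).1 hv
      refine ⟨((u⁻¹ : (ℤ_[p])ˣ) : ℤ_[p]) ^ 2 * D, ?_, ?_⟩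
      · have h1 : ((u⁻¹ : (ℤ_[p])ˣ) : ℤ_[p]) * u = 1 := by simp
        linear_combination ((u⁻¹ : (ℤ_[p])ˣ) : ℤ_[p]) ^ 2 * hD -
          s * (((u⁻¹ : (ℤ_[p])ˣ) : ℤ_[p]) * u + 1) * h1
      · rw [map_mul, map_pow, sq_mul_mem p R₂ hR₂ _ _ ((toZMod_ne_zero_iff p _).2 (Units.isUnit _))]
        exact hDR
    · rintro ⟨D, rfl, hDR⟩
      refine ⟨v ^ 2 * D, by ring, ?_⟩
      rw [map_mul, map_pow, sq_mul_mem p R₂ hR₂ _ _ hv]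
      exact hDR
  constructor
  · rintro ⟨h1, h2⟩
    have hB : PadicInt.toZMod (gmap p c (s - 3 * t ^ 2) t) ≠ 0 := fun h => z1 (h ▸ h1)
    have hD := zP _ _ h2
    simp only [map_add, map_mul, map_pow, map_ofNat] at hD
    have hA : PadicInt.toZMod (s - 3 * t ^ 2) ≠ 0 := by
      intro h
      rw [h] at hD
      have : (27 : ZMod p) = 3 ^ 3 := by norm_num
      rw [this] at hD
      simp [n3] at hD
      exact hB hD
    have hu := (toZMod_ne_zero_iff p _).1 hA
    have hs := (key2 hu).1 h2
    have ht : PadicInt.toZMod t ≠ 0 := by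
      intro h
      apply hB
      simp [gmap, hu, h]
    exact ⟨hs, (key hu (zP _ _ hs) ht).1 h1⟩
  · rintro ⟨h1, h2⟩
    have hs := zP _ _ h1
    have ht : PadicInt.toZMod t ≠ 0 := by
      intro h
      rw [h, mul_zero] at h2
      exact z1 h2
    have hA : PadicInt.toZMod (s - 3 * t ^ 2) ≠ 0 := by
      simp only [map_sub, map_mul, map_pow, map_ofNat, hs]
      simp [n3, ht]
    have hu := (toZMod_ne_zero_iff p _).1 hA
    exact ⟨(key hu hs ht).2 h2, (key2 hu).2 h1⟩

open Classical in
lemma card_two (p : ℕ) [Fact p.Prime] (hp : 5 ≤ p) (R : Set (ZMod p)) :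
    ({x | 2 * x ∈ R} : Set (ZMod p)).toFinset.card = R.toFinset.card := by
  obtain ⟨n2, n3⟩ := four_ne p hp
  refine Finset.card_bij (fun x _ => 2 * x) ?_ ?_ ?_
  · intro a ha; simpa using ha
  · intro a _ b _ h; exact mul_left_cancel₀ n2 h
  · intro b hb
    refine ⟨b / 2, ?_, ?_⟩
    · simpa [mul_div_cancel₀ _ n2] using hb
    · field_simp

open Classical in
lemma meas_S1 (p : ℕ) [Fact p.Prime] (hp : 5 ≤ p) (m : Measure ℤ_[p]) [m.IsAddHaarMeasure]
    [IsProbabilityMeasure m]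
    (n : ℕ) (hn : 0 < n) (R₁ R₂ : Set (ZMod p))
    (hR₁ : R₁ = {x : ZMod p | x ≠ 0 ∧ IsSquare x} ∨ R₁ = {x : ZMod p | x ≠ 0 ∧ ¬ IsSquare x})
    (hR₂ : R₂ = {x : ZMod p | x ≠ 0 ∧ IsSquare x} ∨ R₂ = {x : ZMod p | x ≠ 0 ∧ ¬ IsSquare x}) :
    ((m.prod m) (S1 p n R₁ R₂)).toReal = ((p : ℝ) - 1) ^ 2 / (4 * (p : ℝ) ^ (n + 2)) := by
  obtain ⟨n2, n3⟩ := four_ne p hp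
  have u3 : IsUnit (3 : ℤ_[p]) := by
    rw [← toZMod_ne_zero_iff, map_ofNat]; exact n3
  have u2 : IsUnit (2 : ℤ_[p]) := by
    rw [← toZMod_ne_zero_iff, map_ofNat]; exact n2
  obtain ⟨c, hc⟩ := u3.dvd (a := (-2 : ℤ_[p]))
  have uc : IsUnit c := by
    have : IsUnit (3 * c) := hc ▸ u2.neg
    exact (IsUnit.mul_iff.1 this).2
  rw [← (Psi_pres p c uc m).measure_preimage (measurable_S1 p n R₁ R₂).nullMeasurableSet,
    Psi_preimage p hp c hc.symm n hn R₁ R₂ hR₁ hR₂, Measure.prod_prod, ENNReal.toReal_mul]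
  have hfi : (AddMonoidHom.mulLeft ((p : ℤ_[p]) ^ n)).range.FiniteIndex := ⟨by
      rw [index_mul]; exact pow_ne_zero _ (Fact.out : p.Prime).ne_zero⟩
  have e1 := haar_scale m _ (openEmb_mul p n) _ (open_toZMod p R₂).measurableSet
  have e2 := meas_toZMod p m R₂
  have e3 := meas_toZMod p m {x | 2 * x ∈ R₁}
  rw [card_two p hp] at e3
  rw [index_mul] at e1
  have c1 := card_R p hp R₁ hR₁
  have c2 := card_R p hp R₂ hR₂
  change _ * m (ResSet p n R₂) = _ at e1
  have e1 := congrArg ENNReal.toReal e1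
  have e2 := congrArg ENNReal.toReal e2
  have e3 := congrArg ENNReal.toReal e3
  simp only [ENNReal.toReal_mul, ENNReal.toReal_natCast] at e1 e2 e3
  rw [← e1] at e2
  have c1 : 2 * (R₁.toFinset.card : ℝ) + 1 = p := by exact_mod_cast c1
  have c2 : 2 * (R₂.toFinset.card : ℝ) + 1 = p := by exact_mod_cast c2
  rw [← e3] at c1
  rw [← e2] at c2
  have hp0 : (p : ℝ) ≠ 0 := by positivity
  push_cast at c2
  rw [eq_div_iff (by positivity)]
  generalize (m (ResSet p n R₂)).toReal = x at *
  generalize (m _).toReal = y at *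
  have c1 : 2 * (p * y) = (p : ℝ) - 1 := by linarith
  have c2 : 2 * (p * (p ^ n * x)) = (p : ℝ) - 1 := by linarith
  rw [sq]
  nth_rw 1 [← c1]
  rw [← c2]
  ring

lemma meas_scale (p : ℕ) [Fact p.Prime] (μ : Measure (ℤ_[p] × ℤ_[p]))
    [μ.IsAddHaarMeasure] [IsProbabilityMeasure μ] (X : Set (ℤ_[p] × ℤ_[p])) (hX : MeasurableSet X) :
    (p : ℝ) ^ 5 * (μ ((fun x => ((p : ℤ_[p]) ^ 2 * x.1, (p : ℤ_[p]) ^ 3 * x.2)) '' X)).toReal =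
      (μ X).toReal := by
  set f := (AddMonoidHom.mulLeft ((p : ℤ_[p]) ^ 2)).prodMap (AddMonoidHom.mulLeft ((p : ℤ_[p]) ^ 3))
  have hi : f.range.index = p ^ 5 := by
    rw [AddMonoidHom.range_prodMap, AddSubgroup.index_prod, index_mul, index_mul]
    ring
  have hfi : f.range.FiniteIndex := ⟨by
      rw [hi]; exact pow_ne_zero _ (Fact.out : p.Prime).ne_zero⟩
  have hf : Topology.IsOpenEmbedding f := (openEmb_mul p 2).prodMap (openEmb_mul p 3)
  have h := haar_scale μ f hf X hX
  rw [← h, hi, ENNReal.toReal_mul]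
  simp
  left
  rfl

lemma S2_eq (p : ℕ) [Fact p.Prime] (hp : 5 ≤ p) (n : ℕ) (R₁ R₂ : Set (ZMod p)) :
    {AB : ℤ_[p] × ℤ_[p] | AB.2 ∈ ResSet p 3 R₁ ∧ 4 * AB.1 ^ 3 + 27 * AB.2 ^ 2 ∈ ResSet p (n + 6) R₂} =
      (fun x : ℤ_[p] × ℤ_[p] => ((p : ℤ_[p]) ^ 2 * x.1, (p : ℤ_[p]) ^ 3 * x.2)) '' S1 p n R₁ R₂ := by
  obtain ⟨n2, n3⟩ := four_ne p hp
  have hp0 : (p : ℤ_[p]) ≠ 0 := by exact_mod_cast (Fact.out : p.Prime).ne_zero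
  ext ⟨A, B⟩
  simp only [Set.mem_ofPred_eq, Set.mem_image, S1, Prod.exists, Prod.mk.injEq, mem_ResSet]
  constructor
  · rintro ⟨⟨B', rfl, hB⟩, D, hD, hDR⟩
    have u4 : IsUnit (4 : ℤ_[p]) := by
      rw [← toZMod_ne_zero_iff, map_ofNat]
      have : (4 : ZMod p) = 2 ^ 2 := by norm_num
      rw [this]
      exact pow_ne_zero _ n2
    have h6 : ((p : ℤ_[p]) ^ 2) ^ 3 ∣ A ^ 3 := by
      rw [← u4.dvd_mul_left]
      refine ⟨p ^ n * D - 27 * B' ^ 2, ?_⟩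
      linear_combination hD
    have h2 : (p : ℤ_[p]) ^ 2 ∣ A := by
      have h7 := (PadicInt.norm_le_pow_iff_mem_span_pow (A ^ 3) 6).2
        (Ideal.mem_span_singleton.2 (by rw [← pow_mul] at h6; exact h6))
      rw [← Ideal.mem_span_singleton, ← PadicInt.norm_le_pow_iff_mem_span_pow]
      rw [norm_pow] at h7
      refine le_of_pow_le_pow_left₀ (n := 3) (by norm_num) (by positivity) (h7.trans_eq ?_)
      rw [← zpow_natCast, ← zpow_mul]
      norm_num
    obtain ⟨A', rfl⟩ := h2
    refine ⟨A', B', ⟨hB, D, ?_, hDR⟩, rfl, rfl⟩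
    apply mul_left_cancel₀ (pow_ne_zero 6 hp0)
    linear_combination hD
  · rintro ⟨A', B', ⟨hB, D, hD, hDR⟩, rfl, rfl⟩
    exact ⟨⟨B', rfl, hB⟩, D, by linear_combination (p : ℤ_[p]) ^ 6 * hD, hDR⟩

/-- For a prime `p ≥ 5`, `n > 0`, `μ` the Haar probability measure on `ℤ_p²`, and `R₁, R₂` each
either the nonzero squares or the nonsquares of `F_p^×`:
(i) the density of pairs `(A,B)` with `B̄ ∈ R₁`, `v_p(4A³+27B²) = n` and
`(4A³+27B²)p^{-n} mod p ∈ R₂` (Kodaira type `I_n`) is `(p-1)²/(4p^{n+2})`; and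
(ii) the density of pairs with `v_p(B) = 3`, `Bp^{-3} mod p ∈ R₁`, `v_p(4A³+27B²) = n+6` and
`(4A³+27B²)p^{-(n+6)} mod p ∈ R₂` (Kodaira type `I_n*`) is `(p-1)²/(4p^{n+7})`. -/
theorem density_In_and_Instar (p : ℕ) [Fact p.Prime] (hp : 5 ≤ p)
    (μ : Measure (ℤ_[p] × ℤ_[p])) (hμ : μ.IsAddHaarMeasure) (hμprob : IsProbabilityMeasure μ)
    (n : ℕ) (hn : 0 < n) (R₁ R₂ : Set (ZMod p))
    (hR₁ : R₁ = {x : ZMod p | x ≠ 0 ∧ IsSquare x} ∨ R₁ = {x : ZMod p | x ≠ 0 ∧ ¬ IsSquare x})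
    (hR₂ : R₂ = {x : ZMod p | x ≠ 0 ∧ IsSquare x} ∨ R₂ = {x : ZMod p | x ≠ 0 ∧ ¬ IsSquare x}) :
    ((μ {AB : ℤ_[p] × ℤ_[p] |
        PadicInt.toZMod AB.2 ∈ R₁ ∧
        ‖4 * AB.1 ^ 3 + 27 * AB.2 ^ 2‖ = (p : ℝ) ^ (-(n : ℤ)) ∧
        ∃ D : ℤ_[p], 4 * AB.1 ^ 3 + 27 * AB.2 ^ 2 = (p : ℤ_[p]) ^ n * D ∧
          PadicInt.toZMod D ∈ R₂}).toReal
      = ((p : ℝ) - 1) ^ 2 / (4 * (p : ℝ) ^ (n + 2))) ∧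
    ((μ {AB : ℤ_[p] × ℤ_[p] |
        ‖AB.2‖ = (p : ℝ) ^ (-3 : ℤ) ∧
        (∃ B' : ℤ_[p], AB.2 = (p : ℤ_[p]) ^ 3 * B' ∧ PadicInt.toZMod B' ∈ R₁) ∧
        ‖4 * AB.1 ^ 3 + 27 * AB.2 ^ 2‖ = (p : ℝ) ^ (-((n : ℤ) + 6)) ∧
        ∃ D : ℤ_[p], 4 * AB.1 ^ 3 + 27 * AB.2 ^ 2 = (p : ℤ_[p]) ^ (n + 6) * D ∧
          PadicInt.toZMod D ∈ R₂}).toReal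
      = ((p : ℝ) - 1) ^ 2 / (4 * (p : ℝ) ^ (n + 7))) := by
  have z1 := zero_notMem p R₁ hR₁
  have z2 := zero_notMem p R₂ hR₂
  have hp0 : (p : ℝ) ≠ 0 := by positivity
  let m : Measure ℤ_[p] := Measure.addHaarMeasure ⊤
  have hm : IsProbabilityMeasure m := ⟨Measure.addHaarMeasure_self⟩
  have hμm : μ = m.prod m := Measure.isAddHaarMeasure_eq_of_isProbabilityMeasure _ _
  have h1 := meas_S1 p hp m n hn R₁ R₂ hR₁ hR₂
  rw [← hμm] at h1
  simp only [← mem_ResSet]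
  constructor
  · rw [← h1]
    congr 2
    ext ⟨A, B⟩
    simp only [S1, Set.mem_ofPred_eq]
    refine and_congr_right fun _ => and_iff_right_of_imp fun h => norm_ResSet p n R₂ z2 _ h
  · have h2 := meas_scale p μ _ (measurable_S1 p n R₁ R₂)
    rw [← S2_eq p hp, h1] at h2
    have : {AB : ℤ_[p] × ℤ_[p] | ‖AB.2‖ = (p : ℝ) ^ (-3 : ℤ) ∧ AB.2 ∈ ResSet p 3 R₁ ∧
        ‖4 * AB.1 ^ 3 + 27 * AB.2 ^ 2‖ = (p : ℝ) ^ (-((n : ℤ) + 6)) ∧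
        4 * AB.1 ^ 3 + 27 * AB.2 ^ 2 ∈ ResSet p (n + 6) R₂} = 
        {AB : ℤ_[p] × ℤ_[p] | AB.2 ∈ ResSet p 3 R₁ ∧
          4 * AB.1 ^ 3 + 27 * AB.2 ^ 2 ∈ ResSet p (n + 6) R₂} := by
      ext ⟨A, B⟩
      simp only [Set.mem_ofPred_eq]
      constructor
      · rintro ⟨_, h, _, h'⟩; exact ⟨h, h'⟩
      · rintro ⟨h, h'⟩
        refine ⟨by simpa using norm_ResSet p 3 R₁ z1 _ h, h, ?_, h'⟩
        have := norm_ResSet p (n + 6) R₂ z2 _ h'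
        rw [this]; push_cast; rfl
    rw [this]
    apply mul_left_cancel₀ (pow_ne_zero 5 hp0)
    rw [h2]
    field_simp
    ring

end
end
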